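/- Let 1 ≤ m ≤ d be integers, let a_1, …, a_m be pairwise distinct nonzero real numbers, let E ⊆ ℝ be a Borel set and s ∈ ℂ. Assume that Z^{E,s}_d ≠ 0, that Z^{E,s}_{d+1−j} ≠ 0 for every 1 ≤ j ≤ m, that Z_d(a_1,…,a_m) ≠ 0, that Z_{d+1−j}(a_k) ≠ 0 for all 1 ≤ j,k ≤ m, and that det[ a_k^{m−j} Z_{d+1−j}(a_k) ]_{j,k=1}^{m} ≠ 0. Then 𝔈̄_d(a_1, …, a_m; E; s) = det[ a_k^{m−j} · Z_{d+1−j}(a_k) · 𝔈̄_{d+1−j}(a_k; E; s) ]_{j,k=1}^{m} / det[ a_k^{m−j} · Z_{d+1−j}(a_k) ]_{j,k=1}^{m}. -/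

import Mathlib

open MeasureTheory
open scoped BigOperators

/-- The Vandermonde product `Δ(λ) = ∏_{i<j} (λ_j − λ_i)`. -/
def vandermondeProd {d : ℕ} (l : Fin d → ℝ) : ℝ :=
  ∏ p ∈ Finset.univ.filter (fun p : Fin d × Fin d => p.1 < p.2), (l p.2 - l p.1)

/-- The pairs `(j,k)` with `0 ≤ j < k < m`. -/
def pairsBelow (m : ℕ) : Finset (ℕ × ℕ) :=
  (Finset.range m ×ˢ Finset.range m).filter (fun p => p.1 < p.2)

/-- The normalized partition function `Z_d(a_0,…,a_{m−1})` of the Hermitian matrix model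
with external source eigenvalues `(a_0,…,a_{m−1},0,…,0)` and (complex-valued) weight `V`:
`Z_d(a) = [∏_{i=0}^{d−m−1} i! · ∏_{j<k<m} (a_k − a_j) · ∏_{k<m} a_k^{d−m}]⁻¹
  ∫_{ℝ^d} det B(λ) Δ(λ) ∏ V(λ_i) dλ`,
where `B(λ)_{i,k} = λ_k^i` for `i < d−m` and `B(λ)_{i,k} = e^{a_{i−(d−m)} λ_k}` otherwise. -/
noncomputable def ZpartC (V : ℝ → ℂ) (d m : ℕ) (a : ℕ → ℝ) : ℂ :=
  ((∏ i ∈ Finset.range (d - m), (Nat.factorial i : ℂ)) *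
      (∏ p ∈ pairsBelow m, ((a p.2 : ℂ) - (a p.1 : ℂ))) *
      ∏ k ∈ Finset.range m, (a k : ℂ) ^ (d - m))⁻¹ *
    ∫ l : Fin d → ℝ,
      (Matrix.of fun i k : Fin d =>
          if (i : ℕ) < d - m then (l k : ℂ) ^ (i : ℕ)
          else Complex.exp ((a ((i : ℕ) - (d - m)) : ℂ) * l k)).det *
        (vandermondeProd l : ℂ) * ∏ i : Fin d, V (l i)

/-- The real weight `W` regarded as a complex weight. -/
noncomputable def weightC (W : ℝ → ℝ) : ℝ → ℂ := fun x => (W x : ℂ)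

/-- The deformed complex weight `W_{E,s}(x) = W(x)(1 − s·χ_E(x))`. -/
noncomputable def weightEs (W : ℝ → ℝ) (E : Set ℝ) (s : ℂ) : ℝ → ℂ :=
  fun x => (W x : ℂ) * (1 - s * E.indicator (fun _ => (1 : ℂ)) x)

/-- `𝔈_d(a_0,…,a_{m−1}; E; s) = Z^{E,s}_d(a_0,…,a_{m−1}) / Z_d(a_0,…,a_{m−1})`,
the expectation of `∏_j (1 − s·χ_E(λ_j))` over the eigenvalues of the external
source model. -/
noncomputable def Efrak (W : ℝ → ℝ) (E : Set ℝ) (s : ℂ) (d m : ℕ) (a : ℕ → ℝ) : ℂ :=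
  ZpartC (weightEs W E s) d m a / ZpartC (weightC W) d m a

/-- `𝔈̄_d(a; E; s) = 𝔈_d(a; E; s) / 𝔈_d(E; s)`. -/
noncomputable def Ebar (W : ℝ → ℝ) (E : Set ℝ) (s : ℂ) (d m : ℕ) (a : ℕ → ℝ) : ℂ :=
  Efrak W E s d m a / Efrak W E s d 0 a

/-- The determinant of the `d × d` matrix whose first `n` rows are the rows of `h`, followed by
the rows of `v`. -/
noncomputable def mixedDet {R : Type*} [CommRing R] (d n : ℕ) (h v : ℕ → ℕ → R) : R :=
  (Matrix.of fun i l : Fin d => if (i : ℕ) < n then h i l else v ((i : ℕ) - n) l).det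

/-- The leading principal minor of size `n`. -/
noncomputable def leadingMinor {R : Type*} [CommRing R] (n : ℕ) (h : ℕ → ℕ → R) : R :=
  (Matrix.of fun i l : Fin n => h i l).det

/-- The cofactor of the `l`-th entry of the last row in a matrix of size `r + 1` whose first `r`
rows are those of `h`; zero when `l > r`. -/
noncomputable def lastRowCofactor {R : Type*} [CommRing R] (h : ℕ → ℕ → R) (r l : ℕ) : R :=
  if hl : l < r + 1 then
    (-1) ^ (r + l) * (Matrix.of fun i k : Fin r => h i ((⟨l, hl⟩ : Fin (r + 1)).succAbove k)).det
  else 0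

section Algebra

variable {R : Type*} [CommRing R]

lemma lastRowCofactor_self (h : ℕ → ℕ → R) (r : ℕ) :
    lastRowCofactor h r r = leadingMinor r h := by
  have : (⟨r, Nat.lt_succ_self r⟩ : Fin (r + 1)) = Fin.last r := rfl
  simp [lastRowCofactor, leadingMinor, this, Even.neg_one_pow ⟨r, rfl⟩]

lemma lastRowCofactor_of_lt (h : ℕ → ℕ → R) {r l : ℕ} (hl : r < l) :
    lastRowCofactor h r l = 0 := by
  simp [lastRowCofactor, show ¬ l < r + 1 by omega]

lemma mixedDet_succ_eq_sum (h : ℕ → ℕ → R) (w : ℕ → R) (r : ℕ) :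
    mixedDet (r + 1) r h (fun _ => w) =
      ∑ l ∈ Finset.range (r + 1), w l * lastRowCofactor h r l := by
  rw [mixedDet, Matrix.det_succ_row _ (Fin.last r),
    ← Fin.sum_univ_eq_sum_range (fun l => w l * lastRowCofactor h r l)]
  refine Finset.sum_congr rfl fun l _ => ?_
  have : Matrix.submatrix (Matrix.of fun i l : Fin (r + 1) =>
      if (i : ℕ) < r then h i l else w l) (Fin.last r).succAbove l.succAbove =
      Matrix.of fun i k : Fin r => h i (l.succAbove k) := by
    ext i k
    simp
  rw [this, lastRowCofactor, dif_pos l.2]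
  simp
  ring

lemma mixedDet_succ_eq_sum_of_le (h : ℕ → ℕ → R) (w : ℕ → R) {r d : ℕ} (hrd : r + 1 ≤ d) :
    mixedDet (r + 1) r h (fun _ => w) =
      ∑ l ∈ Finset.range d, w l * lastRowCofactor h r l := by
  rw [mixedDet_succ_eq_sum]
  refine Finset.sum_subset (Finset.range_mono hrd) fun l _ hl => ?_
  rw [lastRowCofactor_of_lt h (by simpa using hl), mul_zero]

lemma mixedDet_succ_row_eq_zero (h : ℕ → ℕ → R) {i r : ℕ} (hi : i < r) :
    mixedDet (r + 1) r h (fun _ => h i) = 0 := by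
  refine Matrix.det_zero_of_row_eq (i := ⟨i, by omega⟩) (j := Fin.last r) ?_ ?_
  · intro e
    have := congrArg Fin.val e
    simp at this
    omega
  · ext l
    simp [hi]

lemma sum_fin_add_sum_fin (f : ℕ → R) (n m : ℕ) :
    ∑ i : Fin n, f i + ∑ j : Fin m, f (n + j) = ∑ i ∈ Finset.range (n + m), f i := by
  rw [Finset.sum_range_add, Fin.sum_univ_eq_sum_range f,
    Fin.sum_univ_eq_sum_range (fun j => f (n + j))]

lemma mixedDet_mul_prod_leadingMinor_aux (n m : ℕ) (h v : ℕ → ℕ → R) :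
    mixedDet (n + m) n h v * ∏ j ∈ Finset.range m, leadingMinor (n + j) h =
      leadingMinor n h *
        (Matrix.of fun j k : Fin m => mixedDet (n + j + 1) (n + j) h (fun _ => v k)).det := by
  set T : Matrix (Fin n ⊕ Fin m) (Fin n ⊕ Fin m) R := Matrix.fromBlocks 1
    (Matrix.of fun i j => lastRowCofactor h (n + (j : ℕ)) i) 0
    (Matrix.of fun i j => lastRowCofactor h (n + (j : ℕ)) (n + i)) with hT
  set M : Matrix (Fin n ⊕ Fin m) (Fin n ⊕ Fin m) R := Matrix.fromBlocks
    (Matrix.of fun i l => h i l) (Matrix.of fun i l => h i (n + l))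
    (Matrix.of fun k l => v k l) (Matrix.of fun k l => v k (n + l)) with hM
  have hMdet : M.det = mixedDet (n + m) n h v := by
    rw [mixedDet, ← Matrix.det_submatrix_equiv_self finSumFinEquiv]
    congr 1
    ext (i | i) (j | j) <;> simp [hM]
  have hTdet : T.det = ∏ j ∈ Finset.range m, leadingMinor (n + j) h := by
    rw [hT, Matrix.det_fromBlocks_zero₂₁, Matrix.det_one, one_mul, Matrix.det_of_isUpperTriangular]
    · rw [← Fin.prod_univ_eq_prod_range (fun j => leadingMinor (n + j) h)]
      simp [lastRowCofactor_self]
    · intro i j hij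
      have hij' : (j : ℕ) < i := hij
      exact lastRowCofactor_of_lt h (by omega)
  have hMT : M * T = Matrix.fromBlocks (Matrix.of fun i l : Fin n => h i l) 0
      (Matrix.of fun (k : Fin m) (l : Fin n) => v k l)
      (Matrix.of fun j k : Fin m => mixedDet (n + j + 1) (n + j) h (fun _ => v k)).transpose := by
    rw [hM, hT, Matrix.fromBlocks_multiply]
    congr 1
    · simp
    · ext i j
      simp only [Matrix.add_apply, Matrix.mul_apply, Matrix.of_apply, Matrix.zero_apply]
      rw [sum_fin_add_sum_fin (fun l => h i l * lastRowCofactor h (n + j) l),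
        ← mixedDet_succ_eq_sum_of_le h (h i) (by omega), mixedDet_succ_row_eq_zero h (by omega)]
    · simp
    · ext k j
      simp only [Matrix.add_apply, Matrix.mul_apply, Matrix.of_apply, Matrix.transpose_apply]
      rw [sum_fin_add_sum_fin (fun l => v k l * lastRowCofactor h (n + j) l),
        ← mixedDet_succ_eq_sum_of_le h (v k) (by omega)]
  rw [← hMdet, ← hTdet, ← Matrix.det_mul, hMT, Matrix.det_fromBlocks_zero₁₂,
    Matrix.det_transpose, leadingMinor]

lemma map_leadingMinor {S : Type*} [CommRing S] (f : R →+* S) (n : ℕ) (h : ℕ → ℕ → R) :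
    f (leadingMinor n h) = leadingMinor n (fun i l => f (h i l)) := by
  rw [leadingMinor, RingHom.map_det]
  rfl

lemma map_mixedDet {S : Type*} [CommRing S] (f : R →+* S) (d n : ℕ) (h v : ℕ → ℕ → R) :
    f (mixedDet d n h v) = mixedDet d n (fun i l => f (h i l)) (fun i l => f (v i l)) := by
  rw [mixedDet, RingHom.map_det, mixedDet]
  congr 1
  ext i l
  simp [apply_ite f]

/-- A mixed determinant with `m + 1` extra rows, times the intermediate leading principal minors,
is the determinant of the mixed determinants with a single extra row. -/
lemma mixedDet_mul_prod_leadingMinor [IsDomain R] (n m : ℕ) (h v : ℕ → ℕ → R) :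
    mixedDet (n + (m + 1)) n h v * ∏ j ∈ Finset.range m, leadingMinor (n + 1 + j) h =
      (Matrix.of fun j k : Fin (m + 1) =>
        mixedDet (n + j + 1) (n + j) h (fun _ => v k)).det := by
  let h' : ℕ → ℕ → Polynomial R :=
    fun i l => Polynomial.C (h i l) + if i = l then Polynomial.X else 0
  let v' : ℕ → ℕ → Polynomial R := fun i l => Polynomial.C (v i l)
  have hne : leadingMinor n h' ≠ 0 := by
    have e : leadingMinor n h' = (-(Matrix.of fun i l : Fin n => h i l)).charpoly := by
      rw [leadingMinor, Matrix.charpoly]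
      congr 1
      ext1 i l
      by_cases hil : i = l
      · subst hil
        simp [h', add_comm]
      · simp [h', hil, Fin.val_inj]
    rw [e]
    exact (Matrix.charpoly_monic _).ne_zero
  have key := mixedDet_mul_prod_leadingMinor_aux n (m + 1) h' v'
  rw [Finset.prod_range_succ', ← mul_assoc, mul_comm _ (leadingMinor (n + 0) h')] at key
  have key' := congrArg (Polynomial.evalRingHom 0) (mul_left_cancel₀ hne key)
  have hh : (fun i l => Polynomial.evalRingHom (0 : R) (h' i l)) = h := by
    ext i l
    by_cases hil : i = l <;> simp [h', hil]
  have hv : (fun i l => Polynomial.evalRingHom (0 : R) (v' i l)) = v := by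
    ext i l
    simp [v']
  rw [map_mul, map_prod, map_mixedDet, RingHom.map_det, hh, hv] at key'
  simp only [map_leadingMinor, hh] at key'
  rw [show ∏ j ∈ Finset.range m, leadingMinor (n + 1 + j) h =
    ∏ j ∈ Finset.range m, leadingMinor (n + (j + 1)) h from
      Finset.prod_congr rfl fun j _ => by rw [add_assoc, add_comm 1 j], key']
  congr 1
  ext j k
  simp only [RingHom.mapMatrix_apply, Matrix.map_apply, Matrix.of_apply]
  rw [map_mixedDet, hh]
  simp [v']

end Algebra

/-- **Andréief's identity.** -/
lemma integral_det_mul_det_mul_prod {d : ℕ} (f g : Fin d → ℝ → ℂ) (V : ℝ → ℂ)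
    (hint : ∀ i j, Integrable fun x => f i x * g j x * V x) :
    ∫ l : Fin d → ℝ, (Matrix.of fun i k => f i (l k)).det * (Matrix.of fun i k => g i (l k)).det *
        ∏ i, V (l i) =
      (d.factorial : ℂ) * (Matrix.of fun i j => ∫ x, f i x * g j x * V x).det := by
  have hexp : ∀ l : Fin d → ℝ,
      (Matrix.of fun i k => f i (l k)).det * (Matrix.of fun i k => g i (l k)).det *
        ∏ i, V (l i) = ∑ τ : Equiv.Perm (Fin d), ∑ σ : Equiv.Perm (Fin d),
          ((Equiv.Perm.sign τ : ℤ) : ℂ) * (((Equiv.Perm.sign σ : ℤ) : ℂ) *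
            ∏ i, (f (σ i) (l i) * g (τ i) (l i) * V (l i))) := by
    intro l
    rw [Matrix.det_apply', Matrix.det_apply', Finset.sum_mul_sum, Finset.sum_comm, Finset.sum_mul]
    refine Finset.sum_congr rfl fun τ _ => ?_
    rw [Finset.sum_mul]
    refine Finset.sum_congr rfl fun σ _ => ?_
    simp only [Finset.prod_mul_distrib, Matrix.of_apply]
    ring
  have hI : ∀ σ τ : Equiv.Perm (Fin d), Integrable fun l : Fin d → ℝ =>
      ∏ i, (f (σ i) (l i) * g (τ i) (l i) * V (l i)) := fun σ τ =>
    Integrable.fintype_prod (f := fun i x => f (σ i) x * g (τ i) x * V x)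
      fun i => hint (σ i) (τ i)
  simp only [hexp]
  rw [integral_finsetSum _ fun τ _ => integrable_finsetSum _ fun σ _ =>
    ((hI σ τ).const_mul _).const_mul _]
  have hτ : ∀ τ : Equiv.Perm (Fin d), ∫ l : Fin d → ℝ, ∑ σ : Equiv.Perm (Fin d),
      ((Equiv.Perm.sign τ : ℤ) : ℂ) * (((Equiv.Perm.sign σ : ℤ) : ℂ) *
            ∏ i, (f (σ i) (l i) * g (τ i) (l i) * V (l i))) =
      (Matrix.of fun i j => ∫ x, f i x * g j x * V x).det := by
    intro τ
    rw [integral_finsetSum _ fun σ _ => ((hI σ τ).const_mul _).const_mul _]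
    simp only [integral_const_mul]
    have hp : ∀ σ : Equiv.Perm (Fin d), ∫ l : Fin d → ℝ,
        ∏ i, (f (σ i) (l i) * g (τ i) (l i) * V (l i)) =
        ∏ i, ∫ x, f (σ i) x * g (τ i) x * V x := fun σ =>
      integral_fintype_prod_volume_eq_prod (fun i x => f (σ i) x * g (τ i) x * V x)
    simp only [hp]
    rw [← Finset.mul_sum]
    have := Matrix.det_permute' τ (Matrix.of fun i j => ∫ x, f i x * g j x * V x)
    rw [Matrix.det_apply'] at this
    simp only [Matrix.submatrix_apply, Matrix.of_apply, id] at this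
    rw [this, ← mul_assoc, ← Int.cast_mul, ← Units.val_mul, Int.units_mul_self]
    simp
  simp only [hτ]
  simp [Fintype.card_perm]

lemma vandermondeProd_eq_det {d : ℕ} (l : Fin d → ℝ) :
    (vandermondeProd l : ℂ) = (Matrix.of fun i k : Fin d => (l k : ℂ) ^ (i : ℕ)).det := by
  have h1 : vandermondeProd l = (Matrix.vandermonde l).det := by
    rw [vandermondeProd, Matrix.det_vandermonde, Finset.prod_filter, Fintype.prod_prod_type]
    refine Finset.prod_congr rfl fun i _ => ?_
    rw [← Finset.prod_filter]
    refine Finset.prod_congr ?_ fun _ _ => rfl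
    ext j
    simp
  have h2 := RingHom.map_det Complex.ofRealHom (Matrix.vandermonde l)
  rw [h1, ← Matrix.det_transpose (Matrix.of _)]
  refine h2.trans ?_
  congr 1
  ext i j
  simp [Matrix.vandermonde]

/-- Integrability of a complex weight against all products of monomials and exponentials. -/
def HasExpMoments (V : ℝ → ℂ) : Prop :=
  ∀ (n : ℕ) (b : ℝ), Integrable fun x : ℝ => (x : ℂ) ^ n * Complex.exp (b * x) * V x

/-- The Hankel moments of `V`. -/
noncomputable def hankelMoment (V : ℝ → ℂ) (i l : ℕ) : ℂ :=
  ∫ x : ℝ, (x : ℂ) ^ i * (x : ℂ) ^ l * V x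

/-- The exponential moments of `V`. -/
noncomputable def expMoment (V : ℝ → ℂ) (b : ℝ) (l : ℕ) : ℂ :=
  ∫ x : ℝ, Complex.exp (b * x) * (x : ℂ) ^ l * V x

/-- The normalization constant in `ZpartC`. -/
noncomputable def ZpartNorm (d m : ℕ) (a : ℕ → ℝ) : ℂ :=
  (∏ i ∈ Finset.range (d - m), (Nat.factorial i : ℂ)) *
      (∏ p ∈ pairsBelow m, ((a p.2 : ℂ) - (a p.1 : ℂ))) *
      ∏ k ∈ Finset.range m, (a k : ℂ) ^ (d - m)

lemma ZpartC_eq_mixedDet {V : ℝ → ℂ} (hV : HasExpMoments V) (d m : ℕ) (a : ℕ → ℝ) :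
    ZpartC V d m a = (ZpartNorm d m a)⁻¹ * ((d.factorial : ℂ) *
      mixedDet d (d - m) (hankelMoment V) (fun k => expMoment V (a k))) := by
  rw [ZpartC, ← ZpartNorm]
  congr 1
  simp only [vandermondeProd_eq_det]
  refine (integral_det_mul_det_mul_prod
    (fun (i : Fin d) (x : ℝ) => if (i : ℕ) < d - m then (x : ℂ) ^ (i : ℕ)
          else Complex.exp ((a ((i : ℕ) - (d - m)) : ℂ) * x))
    (fun (i : Fin d) (x : ℝ) => (x : ℂ) ^ (i : ℕ)) V ?_).trans ?_
  · intro i j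
    split_ifs with h
    · refine (hV (i + j) 0).congr (Filter.Eventually.of_forall fun x => ?_)
      simp [pow_add]
    · refine (hV j (a (i - (d - m)))).congr (Filter.Eventually.of_forall fun x => ?_)
      simp only
      ring
  · rw [mixedDet]
    congr 2
    ext i j
    simp only [Matrix.of_apply]
    split_ifs <;> rfl

lemma ZpartNorm_ne_zero {d m : ℕ} {a : ℕ → ℝ} (hane : ∀ i < m, a i ≠ 0)
    (hadist : ∀ i < m, ∀ j < m, i ≠ j → a i ≠ a j) : ZpartNorm d m a ≠ 0 := by
  refine mul_ne_zero (mul_ne_zero ?_ ?_) ?_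
  · exact Finset.prod_ne_zero_iff.2 fun i _ => Nat.cast_ne_zero.2 (Nat.factorial_ne_zero i)
  · refine Finset.prod_ne_zero_iff.2 fun p hp => ?_
    simp only [pairsBelow, Finset.mem_filter, Finset.mem_product, Finset.mem_range] at hp
    rw [← Complex.ofReal_sub, Complex.ofReal_ne_zero, sub_ne_zero]
    exact hadist _ hp.1.2 _ hp.1.1 hp.2.ne'
  · exact Finset.prod_ne_zero_iff.2 fun k hk =>
      pow_ne_zero _ (Complex.ofReal_ne_zero.2 (hane k (Finset.mem_range.1 hk)))

lemma mixedDet_self {R : Type*} [CommRing R] (d : ℕ) (h v : ℕ → ℕ → R) :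
    mixedDet d d h v = leadingMinor d h := by
  simp [mixedDet, leadingMinor]

/-- The determinant of rank-one partition functions is a weight-independent multiple of the
rank-`m` partition function times partition functions without source. -/
lemma exists_det_ZpartC_eq (m d : ℕ) (hmd : m + 1 ≤ d) (a : ℕ → ℝ)
    (hane : ∀ i < m + 1, a i ≠ 0)
    (hadist : ∀ i < m + 1, ∀ j < m + 1, i ≠ j → a i ≠ a j) :
    ∃ c : ℂ, ∀ V : ℝ → ℂ, HasExpMoments V →
      (Matrix.of fun j k : Fin (m + 1) => (a (k : ℕ) : ℂ) ^ (m - (j : ℕ)) *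
          ZpartC V (d - (j : ℕ)) 1 (fun _ => a (k : ℕ))).det =
        c * (ZpartC V d (m + 1) a * ∏ j ∈ Finset.range m, ZpartC V (d - (j + 1)) 0 a) := by
  obtain ⟨n, rfl⟩ : ∃ n, d = n + (m + 1) := ⟨d - (m + 1), by omega⟩
  set γ : Fin (m + 1) → ℂ := fun j => ((n + (m + 1) - (j : ℕ)).factorial : ℂ) *
    (∏ i ∈ Finset.range (n + (m + 1) - (j : ℕ) - 1), (Nat.factorial i : ℂ))⁻¹ with hγ
  set α : Fin (m + 1) → ℂ := fun k => ((a k : ℂ) ^ n)⁻¹ with hα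
  set κ : ℂ := (ZpartNorm (n + (m + 1)) (m + 1) a)⁻¹ * ((n + (m + 1)).factorial : ℂ) with hκ
  set δ : ℕ → ℂ := fun r => (ZpartNorm r 0 a)⁻¹ * (r.factorial : ℂ) with hδ
  have hκ0 : κ ≠ 0 := mul_ne_zero (inv_ne_zero (ZpartNorm_ne_zero hane hadist))
    (Nat.cast_ne_zero.2 (Nat.factorial_ne_zero _))
  have hδ0 : ∀ r, δ r ≠ 0 := fun r => mul_ne_zero
    (inv_ne_zero (ZpartNorm_ne_zero (by simp) (by simp)))
    (Nat.cast_ne_zero.2 (Nat.factorial_ne_zero _))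
  refine ⟨(∏ j, γ j) * (∏ k, α k) *
    ((Equiv.Perm.sign (Fin.revPerm : Equiv.Perm (Fin (m + 1))) : ℤ) : ℂ) * κ⁻¹ *
    (∏ j ∈ Finset.range m, δ (n + (m + 1) - (j + 1)))⁻¹, fun V hV => ?_⟩
  set h := hankelMoment V
  set v : ℕ → ℕ → ℂ := fun k => expMoment V (a k)
  have hZ : ZpartC V (n + (m + 1)) (m + 1) a = κ * mixedDet (n + (m + 1)) n h v := by
    rw [ZpartC_eq_mixedDet hV, Nat.add_sub_cancel, hκ, mul_assoc]
  have hZ0 : ∀ r, ZpartC V r 0 a = δ r * leadingMinor r h := fun r => by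
    rw [ZpartC_eq_mixedDet hV, Nat.sub_zero, mixedDet_self, hδ, mul_assoc]
  have hprod : ∏ j ∈ Finset.range m, ZpartC V (n + (m + 1) - (j + 1)) 0 a =
      (∏ j ∈ Finset.range m, δ (n + (m + 1) - (j + 1))) *
        ∏ j ∈ Finset.range m, leadingMinor (n + 1 + j) h := by
    simp only [hZ0]
    rw [Finset.prod_mul_distrib]
    congr 1
    rw [← Finset.prod_range_reflect]
    refine Finset.prod_congr rfl fun j hj => ?_
    congr 1
    have := Finset.mem_range.1 hj
    omega
  have hmat : (Matrix.of fun j k : Fin (m + 1) => (a (k : ℕ) : ℂ) ^ (m - (j : ℕ)) *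
          ZpartC V (n + (m + 1) - (j : ℕ)) 1 (fun _ => a (k : ℕ))) =
      Matrix.of fun j k => γ j * (Matrix.of fun j k => α k * (Matrix.submatrix
        (Matrix.of fun j k : Fin (m + 1) => mixedDet (n + j + 1) (n + j) h (fun _ => v k))
          Fin.revPerm id) j k) j k := by
    ext j k
    have hj := j.2
    have e1 : n + (m + 1) - (j : ℕ) = n + (m - j) + 1 := by omega
    have hak : (a k : ℂ) ≠ 0 := Complex.ofReal_ne_zero.2 (hane k k.2)
    have hrev : n + ((Fin.rev j : Fin (m + 1)) : ℕ) = n + (m - j) := by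
      rw [Fin.val_rev]; omega
    simp only [Matrix.of_apply, Matrix.submatrix_apply, Fin.revPerm_apply, id]
    rw [hrev, ZpartC_eq_mixedDet hV, hγ, hα, ZpartNorm]
    simp only [e1, Nat.add_sub_cancel]
    have hpb : pairsBelow 1 = ∅ := by decide
    rw [hpb, Finset.prod_empty, Finset.prod_range_one, mul_one, pow_add]
    field_simp
    rfl
  rw [hmat, Matrix.det_mul_column, Matrix.det_mul_row, Matrix.det_permute,
    ← mixedDet_mul_prod_leadingMinor, hZ, hprod]
  have hP : ∏ j ∈ Finset.range m, δ (n + (m + 1) - (j + 1)) ≠ 0 :=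
    Finset.prod_ne_zero_iff.2 fun j _ => hδ0 _
  field_simp

lemma hasExpMoments_weightEs {W : ℝ → ℝ} (hWmeas : Measurable W)
    (hWint : ∀ (n : ℕ) (b : ℝ), Integrable (fun x => |x| ^ n * Real.exp (b * x) * W x))
    {E : Set ℝ} (hE : MeasurableSet E) (s : ℂ) : HasExpMoments (weightEs W E s) := by
  intro n b
  have hmeas : Measurable fun x : ℝ => (x : ℂ) ^ n * Complex.exp (b * x) * weightEs W E s x := by
    have : Measurable (E.indicator fun _ : ℝ => (1 : ℂ)) := measurable_const.indicator hE
    unfold weightEs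
    fun_prop
  refine ((hWint n b).norm.const_mul (1 + ‖s‖)).mono' hmeas.aestronglyMeasurable
    (Filter.Eventually.of_forall fun x => ?_)
  have h1 : ‖1 - s * E.indicator (fun _ => (1 : ℂ)) x‖ ≤ 1 + ‖s‖ := by
    refine (norm_sub_le _ _).trans ?_
    by_cases hx : x ∈ E <;> simp [hx]
  have h2 : ‖(x : ℂ) ^ n * Complex.exp (b * x) * weightEs W E s x‖ =
      ‖1 - s * E.indicator (fun _ => (1 : ℂ)) x‖ * ‖|x| ^ n * Real.exp (b * x) * W x‖ := by
    rw [weightEs, ← Complex.ofReal_mul, ← Complex.ofReal_exp]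
    simp only [norm_mul, norm_pow, Complex.norm_real, norm_abs_eq_norm]
    simp
    ring
  rw [h2]
  exact mul_le_mul_of_nonneg_right h1 (norm_nonneg _)

lemma weightC_eq_weightEs (W : ℝ → ℝ) : weightC W = weightEs W ∅ 0 := by
  ext x
  simp [weightC, weightEs]

lemma ZpartC_zero_congr (V : ℝ → ℂ) (d : ℕ) (a b : ℕ → ℝ) : ZpartC V d 0 a = ZpartC V d 0 b := by
  have hpb : pairsBelow 0 = ∅ := by decide
  simp [ZpartC, hpb]

/-- Reduction of the rank-`m` expectation to rank-one expectations:
`𝔈̄_d(a_1,…,a_m; E; s) = det[a_k^{m−j} Z_{d+1−j}(a_k) 𝔈̄_{d+1−j}(a_k; E; s)] /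
  det[a_k^{m−j} Z_{d+1−j}(a_k)]`. -/
theorem Ebar_eq_det_ratio_Zpart
    (W : ℝ → ℝ) (hWmeas : Measurable W) (hWnonneg : ∀ x, 0 ≤ W x)
    (hWsupp : (Function.support W).Infinite)
    (hWint : ∀ (n : ℕ) (b : ℝ), Integrable (fun x => |x| ^ n * Real.exp (b * x) * W x))
    (m d : ℕ) (hm : 1 ≤ m) (hmd : m ≤ d)
    (a : ℕ → ℝ)
    (hane : ∀ i < m, a i ≠ 0)
    (hadist : ∀ i < m, ∀ j < m, i ≠ j → a i ≠ a j)
    (E : Set ℝ) (hE : MeasurableSet E) (s : ℂ)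
    (hZE : ZpartC (weightEs W E s) d 0 a ≠ 0)
    (hZEj : ∀ j < m, ZpartC (weightEs W E s) (d - j) 0 a ≠ 0)
    (hZa : ZpartC (weightC W) d m a ≠ 0)
    (hZjk : ∀ j < m, ∀ k < m, ZpartC (weightC W) (d - j) 1 (fun _ => a k) ≠ 0)
    (hdet : (Matrix.of fun j k : Fin m =>
        (a (k : ℕ) : ℂ) ^ (m - 1 - (j : ℕ)) *
          ZpartC (weightC W) (d - (j : ℕ)) 1 (fun _ => a (k : ℕ))).det ≠ 0) :
    Ebar W E s d m a =
      (Matrix.of fun j k : Fin m =>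
          (a (k : ℕ) : ℂ) ^ (m - 1 - (j : ℕ)) *
            ZpartC (weightC W) (d - (j : ℕ)) 1 (fun _ => a (k : ℕ)) *
            Ebar W E s (d - (j : ℕ)) 1 (fun _ => a (k : ℕ))).det /
        (Matrix.of fun j k : Fin m =>
            (a (k : ℕ) : ℂ) ^ (m - 1 - (j : ℕ)) *
              ZpartC (weightC W) (d - (j : ℕ)) 1 (fun _ => a (k : ℕ))).det := by
  obtain ⟨m, rfl⟩ : ∃ m', m = m' + 1 := ⟨m - 1, by omega⟩
  have hV := hasExpMoments_weightEs hWmeas hWint hE s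
  have hV₀ : HasExpMoments (weightC W) :=
    weightC_eq_weightEs W ▸ hasExpMoments_weightEs hWmeas hWint MeasurableSet.empty 0
  obtain ⟨c, hc⟩ := exists_det_ZpartC_eq m d hmd a hane hadist
  simp only [Nat.add_sub_cancel] at hdet ⊢
  have hmat : (Matrix.of fun j k : Fin (m + 1) =>
      (a (k : ℕ) : ℂ) ^ (m - (j : ℕ)) *
        ZpartC (weightC W) (d - (j : ℕ)) 1 (fun _ => a (k : ℕ)) *
        Ebar W E s (d - (j : ℕ)) 1 (fun _ => a (k : ℕ))) =
      Matrix.of fun j k : Fin (m + 1) => (ZpartC (weightC W) (d - (j : ℕ)) 0 a /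
          ZpartC (weightEs W E s) (d - (j : ℕ)) 0 a) *
        (Matrix.of fun j k : Fin (m + 1) => (a (k : ℕ) : ℂ) ^ (m - (j : ℕ)) *
          ZpartC (weightEs W E s) (d - (j : ℕ)) 1 (fun _ => a (k : ℕ))) j k := by
    ext j k
    have h1 := hZjk j j.2 k k.2
    simp only [Matrix.of_apply, Ebar, Efrak]
    rw [ZpartC_zero_congr (weightC W) _ (fun _ => a k) a,
      ZpartC_zero_congr (weightEs W E s) _ (fun _ => a k) a, div_div_eq_mul_div]
    field_simp
  rw [hc _ hV₀] at hdet ⊢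
  rw [hmat, Matrix.det_mul_column, hc _ hV,
    Fin.prod_univ_eq_prod_range (fun j => ZpartC (weightC W) (d - j) 0 a /
      ZpartC (weightEs W E s) (d - j) 0 a), Finset.prod_range_succ', Nat.sub_zero,
    Finset.prod_div_distrib, Ebar, Efrak, Efrak]
  have hc0 := left_ne_zero_of_mul hdet
  have hP₀ := right_ne_zero_of_mul (right_ne_zero_of_mul hdet)
  have hP : ∏ j ∈ Finset.range m, ZpartC (weightEs W E s) (d - (j + 1)) 0 a ≠ 0 :=
    Finset.prod_ne_zero_iff.2 fun j hj => hZEj _ (by have := Finset.mem_range.1 hj; omega)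
  rw [div_div_eq_mul_div]
  field_simp
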